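/- Let $d \ge 1$, $c_1 > 0$, $c \in \mathbb{R}$, and $g_1, g_2 \in \mathbb{R}$. Let $F \subset \mathbb{Z}^d$ be a finite set and $(a_k)_{k \in F}$ complex numbers, and for $j = 1, 2$ define $u_j(x,t) = \sum_{k \in F} a_k \exp\big(-(c_1 \pi^4 |k|^4 + (c+g_j)\pi^2 |k|^2)\,t\big)\, e^{i \pi k \cdot x}$. Suppose there exist $t_1 > 0$ and $k_0 \in F$ with $k_0 \ne 0$ and $a_{k_0} \ne 0$, and suppose $u_1(x, t_1) = u_2(x, t_1)$ for all $x \in \mathbb{R}^d$. Then $g_1 = g_2$. -/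

import Mathlib

open Real in
/-- The character `x ↦ e^{iπ k·x}` of the additive group `ℝ^d`. -/
noncomputable def expChar (d : ℕ) (k : Fin d → ℤ) :
    Multiplicative (EuclideanSpace ℝ (Fin d)) →* ℂ where
  toFun x := Complex.exp ((π : ℂ) * ((∑ i, (k i : ℝ) * (Multiplicative.toAdd x) i : ℝ) : ℂ)
    * Complex.I)
  map_one' := by simp
  map_mul' x y := by
    rw [← Complex.exp_add]
    congr 1
    simp only [toAdd_mul, PiLp.add_apply, mul_add, Finset.sum_add_distrib]
    push_cast
    ring

open Real in
theorem expChar_injective (d : ℕ) : Function.Injective (expChar d) := by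
  intro k l h
  funext j
  by_contra hne
  have hz : ((k j : ℝ) - l j) ≠ 0 := by
    rw [sub_ne_zero]
    exact_mod_cast hne
  have h1 := DFunLike.congr_fun h
    (Multiplicative.ofAdd (EuclideanSpace.single j (1 / ((k j : ℝ) - l j))))
  simp only [expChar, MonoidHom.coe_mk, OneHom.coe_mk, toAdd_ofAdd, PiLp.single_apply,
    mul_ite, mul_zero, Finset.sum_ite_eq', Finset.mem_univ, if_true] at h1
  rw [Complex.exp_eq_exp_iff_exists_int] at h1
  obtain ⟨n, hn⟩ := h1
  have h2 := congrArg Complex.im hn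
  have h3 : π * (k j * (1 / ((k j : ℝ) - l j))) = π * (l j * (1 / ((k j : ℝ) - l j)))
      + n * (2 * π) := by
    have h4 : ((π * (k j * (1 / ((k j : ℝ) - l j))) : ℝ) : ℂ)
      = ((π * (l j * (1 / ((k j : ℝ) - l j))) + n * (2 * π) : ℝ) : ℂ) := by
      apply mul_right_cancel₀ Complex.I_ne_zero
      push_cast at hn ⊢
      rw [hn]
      ring
    exact_mod_cast h4
  have h5 : (1 : ℝ) = 2 * n := by
    apply mul_left_cancel₀ pi_ne_zero
    have : ((k j : ℝ) - l j) * (1 / ((k j : ℝ) - l j)) = 1 := mul_one_div_cancel hz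
    linear_combination h3 - π * this
  have h6 : (1 : ℤ) = 2 * n := by exact_mod_cast h5
  omega

open Real in
theorem constant_coefficient_uniqueness_single_time
    (d : ℕ) (hd : 1 ≤ d) (c1 c g1 g2 : ℝ) (hc1 : 0 < c1)
    (F : Finset (Fin d → ℤ)) (a : (Fin d → ℤ) → ℂ)
    (u1 u2 : EuclideanSpace ℝ (Fin d) → ℝ → ℂ)
    (hu1 : ∀ x t, u1 x t = ∑ k ∈ F, a k *
      Complex.exp (((-((c1 * π ^ 4 * (∑ i, ((k i : ℝ)) ^ 2) ^ 2 +
        (c + g1) * π ^ 2 * (∑ i, ((k i : ℝ)) ^ 2)) * t) : ℝ) : ℂ)) *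
      Complex.exp ((π : ℂ) * ((∑ i, (k i : ℝ) * x i : ℝ) : ℂ) * Complex.I))
    (hu2 : ∀ x t, u2 x t = ∑ k ∈ F, a k *
      Complex.exp (((-((c1 * π ^ 4 * (∑ i, ((k i : ℝ)) ^ 2) ^ 2 +
        (c + g2) * π ^ 2 * (∑ i, ((k i : ℝ)) ^ 2)) * t) : ℝ) : ℂ)) *
      Complex.exp ((π : ℂ) * ((∑ i, (k i : ℝ) * x i : ℝ) : ℂ) * Complex.I))
    (t1 : ℝ) (ht1 : 0 < t1)
    (k0 : Fin d → ℤ) (hk0F : k0 ∈ F) (hk0 : k0 ≠ 0) (ha : a k0 ≠ 0)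
    (hmeas : ∀ x, u1 x t1 = u2 x t1) :
    g1 = g2 := by
  have hli := (linearIndependent_monoidHom (Multiplicative (EuclideanSpace ℝ (Fin d))) ℂ).comp
    _ (expChar_injective d)
  rw [linearIndependent_iff'] at hli
  have key := hli F (fun k => a k *
      Complex.exp (((-((c1 * π ^ 4 * (∑ i, ((k i : ℝ)) ^ 2) ^ 2 +
        (c + g1) * π ^ 2 * (∑ i, ((k i : ℝ)) ^ 2)) * t1) : ℝ) : ℂ)) - a k *
      Complex.exp (((-((c1 * π ^ 4 * (∑ i, ((k i : ℝ)) ^ 2) ^ 2 +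
        (c + g2) * π ^ 2 * (∑ i, ((k i : ℝ)) ^ 2)) * t1) : ℝ) : ℂ))) (by
    funext x
    have h := hmeas (Multiplicative.toAdd x)
    rw [hu1, hu2, ← sub_eq_zero, ← Finset.sum_sub_distrib] at h
    rw [Finset.sum_apply, Pi.zero_apply, ← h]
    refine Finset.sum_congr rfl fun k _ => ?_
    simp only [Pi.smul_apply, Function.comp_apply, smul_eq_mul, expChar, MonoidHom.coe_mk,
      OneHom.coe_mk]
    ring) k0 hk0F
  have h1 := mul_left_cancel₀ ha (sub_eq_zero.mp key)
  have h2 := Real.exp_injective (by exact_mod_cast h1)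
  have hS : 0 < ∑ i, ((k0 i : ℝ)) ^ 2 := by
    obtain ⟨j, hj⟩ := Function.ne_iff.mp hk0
    refine Finset.sum_pos' (fun i _ => sq_nonneg _) ⟨j, Finset.mem_univ _, ?_⟩
    have : (k0 j : ℝ) ≠ 0 := by exact_mod_cast hj
    positivity
  have hne : π ^ 2 * (∑ i, ((k0 i : ℝ)) ^ 2) * t1 ≠ 0 := by positivity
  apply mul_right_cancel₀ hne
  push_cast at h2
  linear_combination -h2
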